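/- Assume r ≥ 1. Let A = (A^{I_1…I_s}_{σ_1…σ_s,i_{s+1}…i_{n−1}})_{0 ≤ s ≤ n−1} be alternating-symmetric families of smooth functions on J^{r−1}, and let L_A be the associated Lagrangian on J^r. For j ∈ Fin n define the smooth function V^j on J^r by V^j := Σ_{s=0}^{n−1} (1/(s!(n−1−s)!)) · Σ ε(j, i_1, …, i_{n−1}) · A^{I_1…I_s}_{σ_1…σ_s, i_{s+1}…i_{n−1}} · Π_{l=1}^{s} y^{σ_l}_{I_l + e_{i_l}}, the inner sum running over all σ_1,…,σ_s ∈ Fin m, all multi-indices I_1,…,I_s of length r−1 and all i_1,…,i_{n−1} ∈ Fin n. Then L_A = Σ_{j ∈ Fin n} d_j V^j as smooth functions on J^{r+1}. (Every hyper-Jacobian Lagrangian is a total divergence.) -/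

import Mathlib

open scoped BigOperators

namespace JetVar

/-- Multi-indices on `Fin n` of degree at most `r`. -/
abbrev MD (n r : ℕ) : Type := {J : Fin n → ℕ // (∑ i, J i) ≤ r}

noncomputable instance (n r : ℕ) : Fintype (MD n r) :=
  Fintype.ofInjective
    (fun J : MD n r => fun i : Fin n =>
      (⟨J.1 i, Nat.lt_succ_of_le ((Finset.single_le_sum
        (fun j _ => Nat.zero_le (J.1 j)) (Finset.mem_univ i)).trans J.2)⟩ : Fin (r+1)))
    (fun _a _b h => Subtype.ext (funext fun i => congrArg Fin.val (congrFun h i)))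

/-- Index set for the `y` coordinates of the `r`-th order jet space. -/
abbrev JIdx (n m r : ℕ) : Type := Fin m × MD n r

/-- The `r`-th order jet coordinate space. -/
abbrev Jet (n m r : ℕ) : Type := ((Fin n) → ℝ) × (JIdx n m r → ℝ)

variable {n m : ℕ}

/-- The coordinate `x^i`. -/
def xc (i : Fin n) {r : ℕ} (p : Jet n m r) : ℝ := p.1 i

/-- The coordinate `y^σ_J` (with the convention that it is `0` for `|J| > r`). -/
def yc (σ : Fin m) (J : Fin n → ℕ) {r : ℕ} (p : Jet n m r) : ℝ :=
  if h : (∑ i, J i) ≤ r then p.2 (σ, ⟨J, h⟩) else 0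

/-- Partial derivative along the coordinate direction `x^i`. -/
noncomputable def pdX (i : Fin n) {r : ℕ} (f : Jet n m r → ℝ) (p : Jet n m r) : ℝ :=
  fderiv ℝ f p (Pi.single i 1, 0)

/-- Partial derivative along the coordinate direction `y^σ_J`
(by convention `0` for `|J| > r`). -/
noncomputable def pdY (σ : Fin m) (J : Fin n → ℕ) {r : ℕ} (f : Jet n m r → ℝ)
    (p : Jet n m r) : ℝ :=
  if h : (∑ i, J i) ≤ r then fderiv ℝ f p (0, Pi.single (σ, (⟨J, h⟩ : MD n r)) 1) else 0

/-- Projection `J^s → J^r` for `r ≤ s`, forgetting higher order coordinates. -/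
def projJet {r s : ℕ} (h : r ≤ s) (p : Jet n m s) : Jet n m r :=
  (p.1, fun q => p.2 (q.1, ⟨q.2.1, q.2.2.trans h⟩))

/-- `J + e_i`. -/
def addE (J : Fin n → ℕ) (i : Fin n) : Fin n → ℕ := fun j => J j + (if j = i then 1 else 0)

/-- `J - e_i` (truncated subtraction). -/
def subE (J : Fin n → ℕ) (i : Fin n) : Fin n → ℕ := fun j => J j - (if j = i then 1 else 0)

/-- The `i`-th formal (total) derivative of a function on `J^r`, a function on `J^{r+1}`. -/
noncomputable def formalD (i : Fin n) {r : ℕ} (f : Jet n m r → ℝ) (p : Jet n m (r+1)) : ℝ :=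
  pdX i f (projJet (Nat.le_succ r) p)
    + ∑ q : JIdx n m r, yc q.1 (addE q.2.1 i) p * pdY q.1 q.2.1 f (projJet (Nat.le_succ r) p)

/-- Iterated formal derivatives along a list of directions. -/
noncomputable def formalDL {r : ℕ} : (l : List (Fin n)) → (Jet n m r → ℝ) →
    (Jet n m (r + l.length) → ℝ)
  | [], f => f
  | i :: l, f => formalD i (formalDL l f)

/-- The canonical list of directions attached to a multi-index
(each `i` repeated `J i` times, in increasing order of `i`). -/
def mlist (J : Fin n → ℕ) : List (Fin n) :=
  (List.finRange n).flatMap (fun i => List.replicate (J i) i)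

lemma mlist_length (J : Fin n → ℕ) : (mlist J).length = ∑ i, J i := by
  rw [mlist, List.length_flatMap]
  simp only [Function.comp_def, List.length_replicate]
  rw [Fin.sum_univ_def]

/-- The iterated formal derivative `d_I`, applying each `d_i` exactly `I i` times
(in increasing order of `i`); a function on `J^{r+|I|}`. -/
noncomputable def formalDI (I : Fin n → ℕ) {r : ℕ} (f : Jet n m r → ℝ)
    (p : Jet n m (r + ∑ i, I i)) : ℝ :=
  formalDL (mlist I) f (projJet (le_of_eq (by rw [mlist_length])) p)

/-- The Lie–Euler expression `E^I_σ(L)` of a function `L` on `J^r`, a function on `J^{2r}`. -/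
noncomputable def LieEuler {r : ℕ} (σ : Fin m) (I : Fin n → ℕ) (L : Jet n m r → ℝ)
    (p : Jet n m (2*r)) : ℝ :=
  ∑ J : MD n r,
    if h : (∑ i, (I i + J.1 i)) ≤ r then
      (-1:ℝ)^(∑ i, J.1 i) * (∏ i, (Nat.choose (I i + J.1 i) (I i) : ℝ)) *
        formalDI J.1 (pdY σ (fun i => I i + J.1 i) L)
          (projJet (by have := J.2; omega) p)
    else 0

/-- The Euler–Lagrange expression `E_σ(L)`. -/
noncomputable def EL {r : ℕ} (σ : Fin m) (L : Jet n m r → ℝ) : Jet n m (2*r) → ℝ :=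
  LieEuler σ (fun _ => 0) L


/-- The sign of a tuple `(i_1,…,i_n)` as a permutation of `Fin n`
(`0` if two entries coincide). -/
noncomputable def epsSign {n : ℕ} (v : Fin n → Fin n) : ℝ :=
  if h : Function.Bijective v then ((Equiv.Perm.sign (Equiv.ofBijective v h) : ℤ) : ℝ) else 0

/-- The hyper-Jacobian `𝒥^{σ_1…σ_s, i_{s+1}…i_n}_{I_1…I_s}`, a function on `J^r`. -/
noncomputable def hyperJ {n m : ℕ} {r : ℕ} (s : ℕ) (hs : s ≤ n)
    (I : Fin s → (Fin n → ℕ)) (σs : Fin s → Fin m) (iv : Fin (n - s) → Fin n)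
    (p : Jet n m r) : ℝ :=
  ∑ w : Fin s → Fin n,
    epsSign (fun a : Fin n => Fin.append w iv (Fin.cast (by omega) a)) *
      ∏ l : Fin s, yc (σs l) (addE (I l) (w l)) p

/-- The truncated formal derivative `δ_i` on functions on `J^t`
(summing only over `|J| ≤ t − 1`). -/
noncomputable def truncD {n m : ℕ} {t : ℕ} (i : Fin n) (f : Jet n m t → ℝ)
    (p : Jet n m t) : ℝ :=
  pdX i f p + ∑ q : JIdx n m (t-1), yc q.1 (addE q.2.1 i) p * pdY q.1 q.2.1 f p

/-- Deleting the `k`-th entry of a tuple. -/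
def delTup {α : Type*} {s : ℕ} (k : Fin s) (f : Fin s → α) : Fin (s-1) → α :=
  fun j =>
    if h : (j : ℕ) < (k : ℕ) then f ⟨j, by have := j.isLt; omega⟩
    else f ⟨(j : ℕ) + 1, by have := j.isLt; omega⟩

/-- The type of families `A^{I_1…I_s}_{σ_1…σ_s, i_{s+1}…i_{n−1}}` of functions on
`J^{r−1}` (with `s` pairs and `n − s − 1` indices in `Fin n`). -/
def JetFam (n m r : ℕ) : Type :=
  (s : ℕ) → (Fin s → (Fin n → ℕ)) → (Fin s → Fin m) → (Fin (n - s - 1) → Fin n) →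
    Jet n m (r-1) → ℝ

/-- Alternating-symmetry of a family: any simultaneous permutation of the pairs and any
permutation of the `Fin n` indices multiplies it by the sign of the permutation. -/
def IsAltSym {n m r : ℕ} (A : JetFam n m r) : Prop :=
  ∀ (s : ℕ) (τ : Equiv.Perm (Fin s)) (ρ : Equiv.Perm (Fin (n - s - 1)))
    (I : Fin s → (Fin n → ℕ)) (σs : Fin s → Fin m) (iv : Fin (n - s - 1) → Fin n)
    (p : Jet n m (r-1)),
    A s (I ∘ τ) (σs ∘ τ) (iv ∘ ρ) p
      = ((Equiv.Perm.sign τ : ℤ) : ℝ) * ((Equiv.Perm.sign ρ : ℤ) : ℝ) * A s I σs iv p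

/-- The coefficients `ℒ^{I_1…I_s}_{σ_1…σ_s, i_{s+1}…i_n}` associated to a family `A`. -/
noncomputable def Lcoef {n m r : ℕ} (A : JetFam n m r) (s : ℕ)
    (I : Fin s → (Fin n → ℕ)) (σs : Fin s → Fin m) (iv : Fin (n - s) → Fin n)
    (p : Jet n m (r-1)) : ℝ :=
  (∑ k : Fin s, (-1:ℝ)^(k:ℕ) *
      pdY (σs k) (I k)
        (A (s-1) (delTup k I) (delTup k σs)
          (fun j : Fin (n - (s-1) - 1) =>
            iv (Fin.cast (by have := k.isLt; omega : n - (s-1) - 1 = n - s) j))) p)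
  + (∑ k : Fin (n - s), (-1:ℝ)^((s:ℕ) + (k:ℕ)) *
      truncD (iv k) (A s I σs (delTup k iv)) p)

/-- The type of coefficient families `C^{I_1…I_s}_{σ_1…σ_s, i_{s+1}…i_n}` of functions
on `J^{r−1}` (with `s` pairs and `n − s` indices in `Fin n`). -/
def CoefFam (n m r : ℕ) : Type :=
  (s : ℕ) → (Fin s → (Fin n → ℕ)) → (Fin s → Fin m) → (Fin (n - s) → Fin n) →
    Jet n m (r-1) → ℝ

/-- Alternating-symmetry for coefficient families. -/
def IsAltSymC {n m r : ℕ} (C : CoefFam n m r) : Prop :=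
  ∀ (s : ℕ) (τ : Equiv.Perm (Fin s)) (ρ : Equiv.Perm (Fin (n - s)))
    (I : Fin s → (Fin n → ℕ)) (σs : Fin s → Fin m) (iv : Fin (n - s) → Fin n)
    (p : Jet n m (r-1)),
    C s (I ∘ τ) (σs ∘ τ) (iv ∘ ρ) p
      = ((Equiv.Perm.sign τ : ℤ) : ℝ) * ((Equiv.Perm.sign ρ : ℤ) : ℝ) * C s I σs iv p

/-- The Lagrangian on `J^r` associated to a coefficient family, a hyper-Jacobian
polynomial in the highest-order derivatives. -/
noncomputable def LagC {n m r : ℕ} (C : CoefFam n m r) (p : Jet n m r) : ℝ :=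
  ∑ s : Fin (n+1),
    (((s:ℕ).factorial * (n - (s:ℕ)).factorial : ℕ) : ℝ)⁻¹ *
      ∑ I : Fin (s:ℕ) → MD n (r-1), ∑ σs : Fin (s:ℕ) → Fin m,
        ∑ iv : Fin (n - (s:ℕ)) → Fin n,
          (if ∀ l, (∑ i, (I l).1 i) = r - 1 then (1:ℝ) else 0) *
            C (s:ℕ) (fun l => (I l).1) σs iv (projJet (Nat.sub_le r 1) p) *
            hyperJ (s:ℕ) (by have := s.isLt; omega) (fun l => (I l).1) σs iv p

/-- The Lagrangian `L_A` associated to a family `A`. -/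
noncomputable def LagA {n m r : ℕ} (A : JetFam n m r) : Jet n m r → ℝ :=
  LagC (fun s I σs iv => Lcoef A s I σs iv)

/-- The open subset `D^t_W` of `J^t` lying over an open set `W` of the total space. -/
def Dset {n m : ℕ} (t : ℕ) (W : Set (((Fin n) → ℝ) × ((Fin m) → ℝ))) :
    Set (Jet n m t) :=
  {p | (p.1, fun σ => yc σ (fun _ => 0) p) ∈ W}

/-- The functions `V^j` built from a family `A`. -/
noncomputable def Vfun {n m r : ℕ} (A : JetFam n m r) (j : Fin n) (p : Jet n m r) : ℝ :=
  ∑ s : Fin n,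
    (((s:ℕ).factorial * (n - 1 - (s:ℕ)).factorial : ℕ) : ℝ)⁻¹ *
      ∑ I : Fin (s:ℕ) → MD n (r-1), ∑ σs : Fin (s:ℕ) → Fin m,
        ∑ u : Fin (n-1) → Fin n,
          (if ∀ l, (∑ i, (I l).1 i) = r - 1 then (1:ℝ) else 0) *
            epsSign (fun a : Fin n =>
              if h : (a : ℕ) = 0 then j else u ⟨(a:ℕ) - 1, by have := a.isLt; omega⟩) *
            A (s:ℕ) (fun l => (I l).1) σs
              (fun t : Fin (n - (s:ℕ) - 1) =>
                u ⟨(s:ℕ) + (t:ℕ), by have := t.isLt; omega⟩)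
              (projJet (Nat.sub_le r 1) p) *
            ∏ l : Fin (s:ℕ),
              yc (σs l) (addE ((I l).1) (u ⟨(l:ℕ), by have := l.isLt; have := s.isLt; omega⟩)) p

/-- `y`-coordinate as a continuous linear map. -/
noncomputable def ycL (σ : Fin m) (J : Fin n → ℕ) (r : ℕ) : Jet n m r →L[ℝ] ℝ :=
  LinearMap.toContinuousLinearMap
    { toFun := fun p => yc σ J p
      map_add' := by intro a b; unfold yc; split_ifs <;> simp
      map_smul' := by intro c b; unfold yc; split_ifs <;> simp }

lemma ycL_apply (σ : Fin m) (J : Fin n → ℕ) (r : ℕ) (p : Jet n m r) :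
    ycL σ J r p = yc σ J p := rfl

/-- The projection as a continuous linear map. -/
noncomputable def projL {r s : ℕ} (h : r ≤ s) : Jet n m s →L[ℝ] Jet n m r :=
  LinearMap.toContinuousLinearMap
    { toFun := fun p => projJet h p
      map_add' := by intro a b; rfl
      map_smul' := by intro c b; rfl }

lemma projL_apply {r s : ℕ} (h : r ≤ s) (p : Jet n m s) : projL h p = projJet h p := rfl

lemma yc_proj {r s : ℕ} (h : r ≤ s) (σ : Fin m) (J : Fin n → ℕ) (hJ : ∑ i, J i ≤ r)
    (p : Jet n m s) : yc σ J (projJet h p) = yc σ J p := by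
  unfold yc
  rw [dif_pos hJ, dif_pos (hJ.trans h)]
  rfl

lemma sum_addE (J : Fin n → ℕ) (i : Fin n) : ∑ a, addE J i a = (∑ a, J a) + 1 := by
  simp [addE, Finset.sum_add_distrib]

lemma addE_comm (J : Fin n → ℕ) (i j : Fin n) : addE (addE J i) j = addE (addE J j) i := by
  funext a; simp only [addE]; ring

/-- The vector in the direction of the formal derivative. -/
noncomputable def vj {s : ℕ} (p : Jet n m s) (j : Fin n) (t : ℕ) : Jet n m t :=
  (Pi.single j 1, fun q => yc q.1 (addE q.2.1 j) p)

lemma clm_expand {t : ℕ} (L : Jet n m t →L[ℝ] ℝ) (x : Fin n → ℝ) (c : JIdx n m t → ℝ) :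
    L (x, c) = L (x, 0) + ∑ q, c q * L (0, Pi.single q 1) := by
  have h1 : ((x, c) : Jet n m t) = (x, 0) + ∑ q, c q • ((0, Pi.single q 1) : Jet n m t) := by
    ext a
    · simp [Prod.fst_sum]
    · simp [Prod.snd_sum, Finset.sum_apply, Pi.single_apply]
  rw [h1, map_add, map_sum]
  simp only [map_smul, smul_eq_mul]

lemma fderiv_vj {s t : ℕ} (f : Jet n m t → ℝ) (p : Jet n m s) (j : Fin n) (q : Jet n m t) :
    fderiv ℝ f q (vj p j t)
      = pdX j f q + ∑ Q : JIdx n m t, yc Q.1 (addE Q.2.1 j) p * pdY Q.1 Q.2.1 f q := by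
  rw [vj, clm_expand]
  unfold pdX pdY
  congr 1
  refine Finset.sum_congr rfl fun Q _ => ?_
  rw [dif_pos Q.2.2]

lemma formalD_eq (j : Fin n) {r : ℕ} (f : Jet n m r → ℝ) (p : Jet n m (r+1)) :
    formalD j f p = fderiv ℝ f (projJet (Nat.le_succ r) p) (vj p j r) := by
  rw [fderiv_vj]; rfl

lemma projJet_vj {s r t : ℕ} (h : t ≤ r) (p : Jet n m s) (j : Fin n) :
    projJet h (vj p j r) = vj p j t := rfl

/-- sums over `MD n t` of a function vanishing in top degree -/
lemma sum_split {t : ℕ} (F : Fin m → (Fin n → ℕ) → ℝ) :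
    ∑ Q : JIdx n m t, F Q.1 Q.2.1
      = (∑ Q : JIdx n m t, if ∑ i, Q.2.1 i = t then F Q.1 Q.2.1 else 0)
        + ∑ Q : JIdx n m (t-1), if ∑ i, Q.2.1 i + 1 ≤ t then F Q.1 Q.2.1 else 0 := by
  have : ∑ Q : JIdx n m (t-1), (if ∑ i, Q.2.1 i + 1 ≤ t then F Q.1 Q.2.1 else 0)
      = ∑ Q : JIdx n m t, (if ∑ i, Q.2.1 i + 1 ≤ t then F Q.1 Q.2.1 else 0) := by
    let e : JIdx n m (t-1) → JIdx n m t := fun Q => (Q.1, ⟨Q.2.1, Q.2.2.trans (Nat.sub_le _ _)⟩)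
    refine Finset.sum_of_injOn e ?_ ?_ ?_ ?_
    · rintro ⟨a, b, hb⟩ _ ⟨c, d, hd⟩ _ h
      simp only [e, Prod.mk.injEq, Subtype.mk.injEq] at h
      obtain ⟨rfl, rfl⟩ := h
      rfl
    · intro x _; simp
    · rintro ⟨a, b, hb⟩ _ h
      rw [if_neg]
      intro h'
      apply h
      exact ⟨(a, ⟨b, by simp only at h'; omega⟩), by simp, rfl⟩
    · intro x _; rfl
  rw [this, ← Finset.sum_add_distrib]
  refine Finset.sum_congr rfl fun Q _ => ?_
  have := Q.2.2
  by_cases h : ∑ i, Q.2.1 i = t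
  · rw [if_pos h, if_neg (by omega)]; simp
  · rw [if_neg h, if_pos (by omega)]; simp

lemma fderiv_vj_trunc {t s : ℕ} (hts : t ≤ s) (f : Jet n m t → ℝ) (p : Jet n m s) (j : Fin n) :
    fderiv ℝ f (projJet hts p) (vj p j t)
      = truncD j f (projJet hts p) + ∑ Q : JIdx n m t, (if ∑ i, Q.2.1 i = t then (1:ℝ) else 0) *
          (yc Q.1 (addE Q.2.1 j) p * pdY Q.1 Q.2.1 f (projJet hts p)) := by
  rw [fderiv_vj, truncD, sum_split (fun σ J => yc σ (addE J j) p * pdY σ J f (projJet hts p))]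
  rw [add_assoc, add_comm (∑ Q : JIdx n m t, _)]
  congr 2
  · refine Finset.sum_congr rfl fun Q _ => ?_
    split_ifs with h
    · rw [yc_proj _ _ _ (by rw [sum_addE]; exact h)]
    · rw [yc, dif_neg (by rw [sum_addE]; exact h), zero_mul]
  · refine Finset.sum_congr rfl fun Q _ => ?_
    split_ifs <;> simp

lemma epsSign_comp (v : Fin n → Fin n) (c : Equiv.Perm (Fin n)) :
    epsSign (v ∘ c) = ((Equiv.Perm.sign c : ℤ) : ℝ) * epsSign v := by
  unfold epsSign
  by_cases h : Function.Bijective v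
  · have h2 : Function.Bijective (v ∘ c) := h.comp c.bijective
    rw [dif_pos h, dif_pos h2]
    have : Equiv.ofBijective (v ∘ c) h2 = Equiv.ofBijective v h * c := by
      ext x; rfl
    rw [this, Equiv.Perm.sign_mul]
    push_cast
    ring
  · have h2 : ¬ Function.Bijective (v ∘ c) := by
      intro h2; apply h
      have := h2.comp c.symm.bijective
      rwa [Function.comp_assoc, Equiv.self_comp_symm, Function.comp_id] at this
    rw [dif_neg h, dif_neg h2, mul_zero]

lemma sum_comp_perm {α : Type*} [Fintype α] (c : Equiv.Perm (Fin n)) (F : (Fin n → α) → ℝ) :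
    ∑ v : Fin n → α, F (v ∘ c) = ∑ v : Fin n → α, F v :=
  Fintype.sum_equiv (Equiv.arrowCongr c.symm (Equiv.refl α)) _ _ (fun v => by
    congr 1)

lemma sum_cons {N : ℕ} {α : Type*} [Fintype α] (F : α → (Fin N → α) → ℝ) :
    ∑ j : α, ∑ u : Fin N → α, F j u = ∑ v : Fin (N+1) → α, F (v 0) (fun a => v a.succ) := by
  rw [← Fintype.sum_prod_type']
  exact Fintype.sum_equiv (Fin.consEquiv (fun _ => α)) _ _ (fun v => by simp [Fin.consEquiv])

lemma sum_insertNth {s : ℕ} {α : Type*} [Fintype α] (k : Fin (s+1)) (F : (Fin (s+1) → α) → ℝ) :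
    ∑ v : Fin (s+1) → α, F v = ∑ j : α, ∑ u : Fin s → α, F (k.insertNth j u) := by
  rw [← Fintype.sum_prod_type' (f := fun j u => F (k.insertNth (α := fun _ => α) j u))]
  exact (Fintype.sum_equiv (Fin.insertNthEquiv (fun _ => α) k) _ _ (fun v => by
    simp [Fin.insertNthEquiv])).symm

lemma sum_append {s : ℕ} (hs : s ≤ n) {α : Type*} [Fintype α]
    (F : (Fin s → α) → (Fin (n-s) → α) → (Fin n → α) → ℝ) :
    ∑ iv : Fin (n-s) → α, ∑ w : Fin s → α,
        F w iv (fun a : Fin n => Fin.append w iv (Fin.cast (by omega) a))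
      = ∑ v : Fin n → α, F (fun l => v ⟨l, by omega⟩) (fun k => v ⟨s + k, by omega⟩) v := by
  rw [Finset.sum_comm, ← Fintype.sum_prod_type' (f := fun w iv => 
    F w iv (fun a : Fin n => Fin.append w iv (Fin.cast (by omega) a)))]
  let c : Fin (s + (n-s)) ≃ Fin n := finCongr (by omega)
  refine Fintype.sum_equiv ((Fin.appendEquiv s (n-s)).trans
    (Equiv.arrowCongr c (Equiv.refl α))) _ _ ?_
  rintro ⟨w, iv⟩
  have h1 : (fun l : Fin s => Fin.append w iv (Fin.cast (by omega) (⟨l, by omega⟩ : Fin n))) = w := by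
    funext l
    exact Fin.append_left w iv l
  have h2 : (fun l : Fin (n-s) => Fin.append w iv (Fin.cast (by omega) (⟨s+l, by omega⟩ : Fin n))) = iv := by
    funext l
    exact Fin.append_right w iv l
  change _ = F (fun l : Fin s => Fin.append w iv (Fin.cast (by omega) (⟨l, by omega⟩ : Fin n))) 
    (fun l : Fin (n-s) => Fin.append w iv (Fin.cast (by omega) (⟨s+l, by omega⟩ : Fin n))) _
  rw [h1, h2]
  rfl

lemma hasFDerivAt_term {t r s : ℕ} (h : t ≤ r) (f : Jet n m t → ℝ) (hf : Differentiable ℝ f)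
    (c : ℝ) (σ : Fin s → Fin m) (J : Fin s → (Fin n → ℕ)) (q : Jet n m r) :
    HasFDerivAt (fun q : Jet n m r => c * f (projJet h q) * ∏ l, yc (σ l) (J l) q)
      ((c * f (projJet h q)) • (∑ l, (∏ l' ∈ Finset.univ.erase l, yc (σ l') (J l') q) •
          ycL (σ l) (J l) r)
        + (∏ l, yc (σ l) (J l) q) • (c • (fderiv ℝ f (projJet h q)).comp (projL h))) q := by
  have h1 : HasFDerivAt (fun q : Jet n m r => f (projJet h q))
      ((fderiv ℝ f (projJet h q)).comp (projL h)) q :=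
    HasFDerivAt.comp q (hf (projJet h q)).hasFDerivAt (projL (n := n) (m := m) h).hasFDerivAt
  have h2 : HasFDerivAt (fun q : Jet n m r => ∏ l, yc (σ l) (J l) q)
      (∑ l, (∏ l' ∈ Finset.univ.erase l, yc (σ l') (J l') q) • ycL (σ l) (J l) r) q :=
    HasFDerivAt.finsetProd (fun l _ => (ycL (σ l) (J l) r).hasFDerivAt)
  exact (h1.const_mul c).mul h2

/-- The indicator of top degree. -/
noncomputable def ind (r : ℕ) {s : ℕ} (I : Fin s → MD n (r-1)) : ℝ :=
  if ∀ l, (∑ i, (I l).1 i) = r - 1 then (1:ℝ) else 0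

/-- The coefficient tuple shift. -/
def shiftT (s : ℕ) (v : Fin n → Fin n) : Fin (n - s - 1) → Fin n :=
  fun t => v ⟨s + t + 1, by have := t.isLt; omega⟩

/-- The truncated part. -/
noncomputable def S2 {N m r : ℕ} (A : JetFam (N+1) m r) (s : ℕ) (hs : s < N+1)
    (q : Jet (N+1) m r) : ℝ :=
  ∑ I : Fin s → MD (N+1) (r-1), ∑ σs : Fin s → Fin m, ∑ v : Fin (N+1) → Fin (N+1),
    ind r I * epsSign v *
      truncD (v 0) (A s (fun l => (I l).1) σs (shiftT s v)) (projJet (Nat.sub_le r 1) q) *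
      ∏ l : Fin s, yc (σs l) (addE (I l).1 (v ⟨l + 1, by omega⟩)) q

/-- The top-degree part. -/
noncomputable def S1 {N m r : ℕ} (A : JetFam (N+1) m r) (s : ℕ) (hs : s < N+1)
    (q : Jet (N+1) m r) : ℝ :=
  ∑ I : Fin s → MD (N+1) (r-1), ∑ σs : Fin s → Fin m, ∑ v : Fin (N+1) → Fin (N+1),
    ind r I * epsSign v *
      (∑ Q : JIdx (N+1) m (r-1), (if ∑ i, Q.2.1 i = r-1 then (1:ℝ) else 0) *
        (yc Q.1 (addE Q.2.1 (v 0)) q *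
          pdY Q.1 Q.2.1 (A s (fun l => (I l).1) σs (shiftT s v)) (projJet (Nat.sub_le r 1) q))) *
      ∏ l : Fin s, yc (σs l) (addE (I l).1 (v ⟨l + 1, by omega⟩)) q

/-- The part with second-order terms, which vanishes. -/
noncomputable def S0 {N m r : ℕ} (A : JetFam (N+1) m r) (s : ℕ) (hs : s < N+1)
    (p : Jet (N+1) m (r+1)) : ℝ :=
  ∑ I : Fin s → MD (N+1) (r-1), ∑ σs : Fin s → Fin m, ∑ v : Fin (N+1) → Fin (N+1),
    ind r I * epsSign v *
      A s (fun l => (I l).1) σs (shiftT s v)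
        (projJet (Nat.sub_le r 1) (projJet (Nat.le_succ r) p)) *
      ∑ l : Fin s, (∏ l' ∈ Finset.univ.erase l,
          yc (σs l') (addE (I l').1 (v ⟨l' + 1, by omega⟩)) (projJet (Nat.le_succ r) p)) *
        yc (σs l) (addE (addE (I l).1 (v ⟨l + 1, by omega⟩)) (v 0)) p

lemma S0_eq_zero {N m r : ℕ} (A : JetFam (N+1) m r) (s : ℕ) (hs : s < N+1)
    (p : Jet (N+1) m (r+1)) : S0 A s hs p = 0 := by
  unfold S0
  refine Finset.sum_eq_zero fun I _ => Finset.sum_eq_zero fun σs _ => ?_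
  simp_rw [Finset.mul_sum]
  rw [Finset.sum_comm]
  refine Finset.sum_eq_zero fun l _ => ?_
  have key : ∀ F : (Fin (N+1) → Fin (N+1)) → ℝ, ∀ c : Equiv.Perm (Fin (N+1)),
      (∀ v, F (v ∘ c) = - F v) → ∑ v, F v = 0 := by
    intro F c hF
    have := sum_comp_perm c F
    simp_rw [hF] at this
    rw [Finset.sum_neg_distrib] at this
    linarith
  have hne : (0 : Fin (N+1)) ≠ ⟨l+1, by omega⟩ := by
    intro h; have := congrArg Fin.val h; simp at this
  apply key _ (Equiv.swap 0 ⟨l+1, by omega⟩)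
  intro v
  rw [epsSign_comp, Equiv.Perm.sign_swap hne]
  have e1 : shiftT s (v ∘ Equiv.swap 0 ⟨l+1, by omega⟩) = shiftT s v := by
    funext t
    simp only [shiftT, Function.comp]
    rw [Equiv.swap_apply_of_ne_of_ne]
    · intro h; have := congrArg Fin.val h; simp at this
    · intro h; have := congrArg Fin.val h; simp at this; omega
  have e2 : ∏ l' ∈ Finset.univ.erase l,
          yc (σs l') (addE (I l').1 ((v ∘ Equiv.swap 0 ⟨l+1, by omega⟩) ⟨l' + 1, by omega⟩))
            (projJet (Nat.le_succ r) p)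
      = ∏ l' ∈ Finset.univ.erase l,
          yc (σs l') (addE (I l').1 (v ⟨l' + 1, by omega⟩)) (projJet (Nat.le_succ r) p) := by
    refine Finset.prod_congr rfl fun l' hl' => ?_
    have hl : l' ≠ l := Finset.ne_of_mem_erase hl'
    simp only [Function.comp]
    rw [Equiv.swap_apply_of_ne_of_ne]
    · intro h; have := congrArg Fin.val h; simp at this
    · intro h; have := congrArg Fin.val h; simp at this; exact hl (Fin.ext this)
  rw [e1, e2]
  simp only [Function.comp, Equiv.swap_apply_left, Equiv.swap_apply_right]
  rw [addE_comm]
  push_cast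
  ring

set_option maxHeartbeats 1000000 in
lemma formalD_Vfun {N m r : ℕ} (hr : 1 ≤ r) (A : JetFam (N+1) m r)
    (hAs : ∀ s I σs iv, ContDiff ℝ (⊤:ℕ∞) (A s I σs iv)) (j : Fin (N+1))
    (p : Jet (N+1) m (r+1)) :
    formalD j (Vfun A j) p = ∑ s : Fin (N+1),
      (((s:ℕ).factorial * (N - (s:ℕ)).factorial : ℕ) : ℝ)⁻¹ *
      ∑ I : Fin (s:ℕ) → MD (N+1) (r-1), ∑ σs : Fin (s:ℕ) → Fin m,
        ∑ u : Fin N → Fin (N+1),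
          (((ind r I * epsSign (fun a : Fin (N+1) =>
              if h : (a : ℕ) = 0 then j else u ⟨(a:ℕ) - 1, by have := a.isLt; omega⟩)) *
            A (s:ℕ) (fun l => (I l).1) σs
              (fun t : Fin (N + 1 - (s:ℕ) - 1) =>
                u ⟨(s:ℕ) + (t:ℕ), by have := t.isLt; omega⟩)
              (projJet (Nat.sub_le r 1) (projJet (Nat.le_succ r) p))) *
            (∑ l : Fin (s:ℕ), (∏ l' ∈ Finset.univ.erase l,
              yc (σs l') (addE (I l').1 (u ⟨(l':ℕ), by have := l'.isLt; have := s.isLt; omega⟩))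
                (projJet (Nat.le_succ r) p)) *
              yc (σs l) (addE (addE (I l).1 (u ⟨(l:ℕ), by have := l.isLt; have := s.isLt; omega⟩)) j) p)
          + (∏ l : Fin (s:ℕ),
              yc (σs l) (addE ((I l).1) (u ⟨(l:ℕ), by have := l.isLt; have := s.isLt; omega⟩))
                (projJet (Nat.le_succ r) p)) *
            ((ind r I * epsSign (fun a : Fin (N+1) =>
              if h : (a : ℕ) = 0 then j else u ⟨(a:ℕ) - 1, by have := a.isLt; omega⟩)) *
            (truncD j (A (s:ℕ) (fun l => (I l).1) σs
              (fun t : Fin (N + 1 - (s:ℕ) - 1) =>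
                u ⟨(s:ℕ) + (t:ℕ), by have := t.isLt; omega⟩))
                (projJet (Nat.sub_le r 1) (projJet (Nat.le_succ r) p))
             + ∑ Q : JIdx (N+1) m (r-1), (if ∑ i, Q.2.1 i = r-1 then (1:ℝ) else 0) *
              (yc Q.1 (addE Q.2.1 j) (projJet (Nat.le_succ r) p) *
                pdY Q.1 Q.2.1 (A (s:ℕ) (fun l => (I l).1) σs
              (fun t : Fin (N + 1 - (s:ℕ) - 1) =>
                u ⟨(s:ℕ) + (t:ℕ), by have := t.isLt; omega⟩))
                  (projJet (Nat.sub_le r 1) (projJet (Nat.le_succ r) p)))))) := by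
  rw [formalD_eq]
  have hd := HasFDerivAt.fun_sum (u := Finset.univ) (fun (s : Fin (N+1)) _ =>
    HasFDerivAt.const_mul (HasFDerivAt.fun_sum (u := Finset.univ)
      (fun (I : Fin (s:ℕ) → MD (N+1) (r-1)) _ =>
      HasFDerivAt.fun_sum (u := Finset.univ) (fun (σs : Fin (s:ℕ) → Fin m) _ =>
      HasFDerivAt.fun_sum (u := Finset.univ) (fun (u : Fin N → Fin (N+1)) _ =>
        hasFDerivAt_term (Nat.sub_le r 1)
          (A (s:ℕ) (fun l => (I l).1) σs
              (fun t : Fin (N + 1 - (s:ℕ) - 1) =>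
                u ⟨(s:ℕ) + (t:ℕ), by have := t.isLt; omega⟩))
          ((hAs _ _ _ _).differentiable (by simp))
          (ind r I * epsSign (fun a : Fin (N+1) =>
              if h : (a : ℕ) = 0 then j else u ⟨(a:ℕ) - 1, by have := a.isLt; omega⟩))
          σs (fun l => addE ((I l).1)
            (u ⟨(l:ℕ), by have := l.isLt; have := s.isLt; omega⟩))
          (projJet (Nat.le_succ r) p)))))
      (((s:ℕ).factorial * (N - (s:ℕ)).factorial : ℕ) : ℝ)⁻¹)
  have hd2 := hd.fderiv
  have hV : fderiv ℝ (Vfun A j) (projJet (Nat.le_succ r) p) = _ := hd2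
  rw [hV]
  simp only [sum_apply, add_apply,
    smul_apply, smul_eq_mul, ContinuousLinearMap.comp_apply, projL_apply,
    ycL_apply, projJet_vj]
  refine Finset.sum_congr rfl fun s _ => ?_
  congr 1
  refine Finset.sum_congr rfl fun I _ => Finset.sum_congr rfl fun σs _ =>
    Finset.sum_congr rfl fun u _ => ?_
  congr 1
  · congr 1
    refine Finset.sum_congr rfl fun l _ => ?_
    congr 1
    rw [yc, dif_pos (by rw [sum_addE]; have := (I l).2; omega)]
    rfl
  · congr 2
    have := fderiv_vj_trunc (Nat.sub_le r 1) (A (s:ℕ) (fun l => (I l).1) σs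
              (fun t : Fin (N + 1 - (s:ℕ) - 1) =>
                u ⟨(s:ℕ) + (t:ℕ), by have := t.isLt; omega⟩))
      (projJet (Nat.le_succ r) p) j
    rw [← this]
    congr 1
    unfold vj
    congr 1
    funext Q
    rw [yc_proj]
    rw [sum_addE]; have := Q.2.2; omega

lemma sum_formalD_Vfun {N m r : ℕ} (hr : 1 ≤ r) (A : JetFam (N+1) m r)
    (hAs : ∀ s I σs iv, ContDiff ℝ (⊤:ℕ∞) (A s I σs iv))
    (p : Jet (N+1) m (r+1)) :
    ∑ j, formalD j (Vfun A j) p = ∑ s : Fin (N+1),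
      (((s:ℕ).factorial * (N - (s:ℕ)).factorial : ℕ) : ℝ)⁻¹ *
      (S2 A s s.2 (projJet (Nat.le_succ r) p) + S1 A s s.2 (projJet (Nat.le_succ r) p)) := by
  simp_rw [formalD_Vfun hr A hAs]
  rw [Finset.sum_comm]
  refine Finset.sum_congr rfl fun s _ => ?_
  rw [← Finset.mul_sum]
  congr 1
  have h0 := S0_eq_zero A s s.2 p
  refine Eq.trans (b := S0 A s s.2 p + (S2 A s s.2 (projJet (Nat.le_succ r) p)
    + S1 A s s.2 (projJet (Nat.le_succ r) p))) ?_ (by rw [h0, zero_add])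
  unfold S0 S1 S2
  simp only [← Finset.sum_add_distrib]
  rw [Finset.sum_comm]
  refine Finset.sum_congr rfl fun I _ => ?_
  rw [Finset.sum_comm]
  refine Finset.sum_congr rfl fun σs _ => ?_
  rw [sum_cons]
  refine Finset.sum_congr rfl fun v _ => ?_
  have e : (fun a : Fin (N+1) =>
              if h : (a : ℕ) = 0 then v 0 else
                v (Fin.succ ⟨(a:ℕ) - 1, by have := a.isLt; omega⟩)) = v := by
    funext a
    split_ifs with h
    · congr 1; exact (Fin.ext h).symm
    · congr 1; apply Fin.ext; simp; omega
  rw [e]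
  have e2 : (fun t : Fin (N + 1 - (s:ℕ) - 1) =>
      v (Fin.succ ⟨(s:ℕ) + (t:ℕ), by have := t.isLt; omega⟩)) = shiftT s v := rfl
  rw [e2]
  simp only [Fin.succ_mk]
  ring

/-- First part of the coefficients. -/
noncomputable def L1 {n m r : ℕ} (A : JetFam n m r) (s : ℕ)
    (I : Fin s → (Fin n → ℕ)) (σs : Fin s → Fin m) (iv : Fin (n - s) → Fin n)
    (p : Jet n m (r-1)) : ℝ :=
  ∑ k : Fin s, (-1:ℝ)^(k:ℕ) *
      pdY (σs k) (I k)
        (A (s-1) (delTup k I) (delTup k σs)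
          (fun j : Fin (n - (s-1) - 1) =>
            iv (Fin.cast (by have := k.isLt; omega : n - (s-1) - 1 = n - s) j))) p

/-- Second part of the coefficients. -/
noncomputable def L2 {n m r : ℕ} (A : JetFam n m r) (s : ℕ)
    (I : Fin s → (Fin n → ℕ)) (σs : Fin s → Fin m) (iv : Fin (n - s) → Fin n)
    (p : Jet n m (r-1)) : ℝ :=
  ∑ k : Fin (n - s), (-1:ℝ)^((s:ℕ) + (k:ℕ)) *
      truncD (iv k) (A s I σs (delTup k iv)) p

/-- The sum of coefficients against hyper-Jacobians. -/
noncomputable def X {n m r : ℕ}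
    (C : (s : ℕ) → (Fin s → (Fin n → ℕ)) → (Fin s → Fin m) → (Fin (n - s) → Fin n) →
      Jet n m (r-1) → ℝ) (s : ℕ) (hs : s ≤ n) (q : Jet n m r) : ℝ :=
  ∑ I : Fin s → MD n (r-1), ∑ σs : Fin s → Fin m, ∑ v : Fin n → Fin n,
    ind r I * C s (fun l => (I l).1) σs (fun k => v ⟨s + k, by omega⟩)
      (projJet (Nat.sub_le r 1) q) *
      (epsSign v * ∏ l : Fin s, yc (σs l) (addE (I l).1 (v ⟨l, by omega⟩)) q)

lemma LagC_eq {n m r : ℕ} (C : CoefFam n m r) (q : Jet n m r) :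
    LagC C q = ∑ s : Fin (n+1), (((s:ℕ).factorial * (n - (s:ℕ)).factorial : ℕ) : ℝ)⁻¹ *
      X C s (Nat.le_of_lt_succ s.2) q := by
  unfold LagC X
  refine Finset.sum_congr rfl fun s _ => ?_
  congr 1
  refine Finset.sum_congr rfl fun I _ => Finset.sum_congr rfl fun σs _ => ?_
  unfold hyperJ
  simp_rw [Finset.mul_sum]
  exact sum_append (Nat.le_of_lt_succ s.2) (fun w iv v => ind r I * C s (fun l => (I l).1) σs iv
      (projJet (Nat.sub_le r 1) q) *
      (epsSign v * ∏ l : Fin s, yc (σs l) (addE (I l).1 (w l)) q))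

lemma LagA_eq {n m r : ℕ} (A : JetFam n m r) (q : Jet n m r) :
    LagA A q = (∑ s : Fin (n+1), (((s:ℕ).factorial * (n - (s:ℕ)).factorial : ℕ) : ℝ)⁻¹ *
      X (fun s I σs iv => L1 A s I σs iv) s (Nat.le_of_lt_succ s.2) q)
     + ∑ s : Fin (n+1), (((s:ℕ).factorial * (n - (s:ℕ)).factorial : ℕ) : ℝ)⁻¹ *
      X (fun s I σs iv => L2 A s I σs iv) s (Nat.le_of_lt_succ s.2) q := by
  refine (LagC_eq _ q).trans ?_
  rw [← Finset.sum_add_distrib]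
  refine Finset.sum_congr rfl fun s _ => ?_
  rw [← mul_add]
  congr 1
  unfold X
  simp only [← Finset.sum_add_distrib]
  refine Finset.sum_congr rfl fun I _ => Finset.sum_congr rfl fun σs _ =>
    Finset.sum_congr rfl fun v _ => ?_
  rw [← add_mul, ← mul_add]
  rfl

lemma cyc_lt {N : ℕ} {i a : ℕ} (hi : i < N+1) (ha : a < N+1) (h : a < i) :
    Fin.cycleRange (⟨i, hi⟩ : Fin (N+1)) ⟨a, ha⟩ = ⟨a+1, by omega⟩ :=
  Fin.ext (Fin.coe_cycleRange_of_lt (by exact h))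

lemma cyc_gt {N : ℕ} {i a : ℕ} (hi : i < N+1) (ha : a < N+1) (h : i < a) :
    Fin.cycleRange (⟨i, hi⟩ : Fin (N+1)) ⟨a, ha⟩ = ⟨a, ha⟩ :=
  Fin.cycleRange_of_gt (by exact h)

lemma cyc_sign {N : ℕ} (i : Fin (N+1)) :
    (((Equiv.Perm.sign (Fin.cycleRange i)) : ℤ) : ℝ) = (-1)^(i:ℕ) := by
  rw [Fin.sign_cycleRange]; push_cast; rfl

lemma X_L2 {N m r : ℕ} (A : JetFam (N+1) m r) (s : ℕ) (hs : s < N+1) (q : Jet (N+1) m r) :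
    X (fun s I σs iv => L2 A s I σs iv) s hs.le q = ((N + 1 - s : ℕ) : ℝ) * S2 A s hs q := by
  unfold X S2 L2
  simp only [Finset.mul_sum (s := Finset.univ (α := Fin s → MD (N+1) (r-1))),
    Finset.mul_sum (s := Finset.univ (α := Fin s → Fin m))]
  refine Finset.sum_congr rfl fun I _ => Finset.sum_congr rfl fun σs _ => ?_
  simp_rw [Finset.mul_sum (s := Finset.univ (α := Fin (N+1-s))), Finset.sum_mul]
  rw [Finset.sum_comm]
  rw [Finset.sum_congr rfl (g := fun _ => ∑ v : Fin (N+1) → Fin (N+1), ind r I * epsSign v *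
      truncD (v 0) (A s (fun l => (I l).1) σs (shiftT s v)) (projJet (Nat.sub_le r 1) q) *
      ∏ l : Fin s, yc (σs l) (addE (I l).1 (v ⟨l + 1, by omega⟩)) q)]
  · rw [Finset.sum_const, Finset.card_univ, Fintype.card_fin, nsmul_eq_mul]
  intro k _
  have hk : s + k < N + 1 := by omega
  rw [← sum_comp_perm (Fin.cycleRange (⟨s + k, hk⟩ : Fin (N+1)))]
  refine Finset.sum_congr rfl fun v _ => ?_
  rw [epsSign_comp, cyc_sign]
  have e1 : delTup k (fun k' : Fin (N+1-s) => (v ∘ Fin.cycleRange (⟨s + k, hk⟩ : Fin (N+1)))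
      ⟨s + k', by omega⟩) = shiftT s v := by
    funext t
    unfold delTup shiftT
    split_ifs with h
    · simp only [Function.comp]
      rw [cyc_lt _ _ (by omega)]
    · simp only [Function.comp]
      rw [cyc_gt _ _ (by omega)]
      rfl
  have e2 : ∏ l : Fin s, yc (σs l) (addE (I l).1
      ((v ∘ Fin.cycleRange (⟨s + k, hk⟩ : Fin (N+1))) ⟨l, by omega⟩)) q
      = ∏ l : Fin s, yc (σs l) (addE (I l).1 (v ⟨l + 1, by omega⟩)) q := by
    refine Finset.prod_congr rfl fun l _ => ?_
    simp only [Function.comp]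
    rw [cyc_lt _ _ (by omega)]
  have e3 : (v ∘ Fin.cycleRange (⟨s + k, hk⟩ : Fin (N+1))) ⟨s + k, hk⟩ = v 0 := by
    simp only [Function.comp]
    rw [Fin.cycleRange_self]
  rw [e1, e2, e3]
  have e4 : ((-1:ℝ)^(s + (k:ℕ))) * ((-1:ℝ)^(s + (k:ℕ))) = 1 := by
    rw [← mul_pow]; simp
  linear_combination (ind r I * epsSign v *
      truncD (v 0) (A s (fun l => (I l).1) σs (shiftT s v)) (projJet (Nat.sub_le r 1) q) *
      ∏ l : Fin s, yc (σs l) (addE (I l).1 (v ⟨l + 1, by omega⟩)) q) * e4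

lemma sum_comm5 {α β γ δ ε : Type*} [Fintype α] [Fintype β] [Fintype γ] [Fintype δ] [Fintype ε]
    (G : α → β → γ → δ → ε → ℝ) :
    ∑ a, ∑ b, ∑ c, ∑ d, ∑ e, G a b c d e = ∑ b, ∑ d, ∑ e, ∑ c, ∑ a, G a b c d e := by
  rw [Finset.sum_comm]
  refine Finset.sum_congr rfl fun b _ => ?_
  refine (Finset.sum_congr rfl (fun a _ => Finset.sum_comm)).trans ?_
  rw [Finset.sum_comm]
  refine Finset.sum_congr rfl fun d _ => ?_
  refine (Finset.sum_congr rfl (fun a _ => Finset.sum_comm)).trans ?_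
  rw [Finset.sum_comm]
  refine Finset.sum_congr rfl fun e _ => ?_
  rw [Finset.sum_comm]

lemma delTup_insertNth {α : Type*} {s : ℕ} (k : Fin (s+1)) (x : α) (f : Fin s → α) :
    delTup k (k.insertNth (α := fun _ => α) x f) = f := by
  funext j
  have : delTup k (k.insertNth (α := fun _ => α) x f) j
      = k.insertNth (α := fun _ => α) x f (k.succAbove j) := by
    unfold delTup
    split_ifs with h
    · congr 1
      rw [Fin.succAbove_of_castSucc_lt _ _ (by exact h)]; rfl
    · congr 1
      rw [Fin.succAbove_of_le_castSucc _ _ (by exact not_lt.mp h)]; rfl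
  rw [this, Fin.insertNth_apply_succAbove]

lemma ind_insertNth {n r s : ℕ} (k : Fin (s+1)) (x : MD n (r-1)) (f : Fin s → MD n (r-1)) :
    ind r (k.insertNth (α := fun _ => MD n (r-1)) x f)
      = (if ∑ i, x.1 i = r - 1 then (1:ℝ) else 0) * ind r f := by
  unfold ind
  simp only [k.forall_iff_succAbove, Fin.insertNth_apply_same, Fin.insertNth_apply_succAbove]
  by_cases h1 : ∑ i, x.1 i = r - 1 <;> by_cases h2 : ∀ l, ∑ i, (f l).1 i = r - 1 <;> simp [h1, h2]

lemma X_L1 {N m r : ℕ} (A : JetFam (N+1) m r) (s : ℕ) (hs : s < N+1) (q : Jet (N+1) m r) :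
    X (fun s I σs iv => L1 A s I σs iv) (s+1) hs q = ((s + 1 : ℕ) : ℝ) * S1 A s hs q := by
  have step : X (fun s I σs iv => L1 A s I σs iv) (s+1) hs q = ∑ k : Fin (s+1),
      ∑ I : Fin (s+1) → MD (N+1) (r-1), ∑ σs : Fin (s+1) → Fin m, ∑ v : Fin (N+1) → Fin (N+1),
        ind r I * ((-1:ℝ)^(k:ℕ) *
          pdY (σs k) (I k).1
            (A s (delTup k (fun l => (I l).1)) (delTup k σs)
              (fun j : Fin (N + 1 - s - 1) => v ⟨s + 1 + j, by omega⟩))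
              (projJet (Nat.sub_le r 1) q)) *
        (epsSign v * ∏ l : Fin (s+1), yc (σs l) (addE (I l).1 (v ⟨l, by omega⟩)) q) := by
    refine Eq.trans ?_ Finset.sum_comm
    unfold X
    refine Finset.sum_congr rfl fun I _ => ?_
    refine Eq.trans ?_ Finset.sum_comm
    refine Finset.sum_congr rfl fun σs _ => ?_
    refine Eq.trans ?_ Finset.sum_comm
    refine Finset.sum_congr rfl fun v _ => ?_
    unfold L1
    rw [Finset.mul_sum, Finset.sum_mul]
    rfl
  rw [step, Finset.sum_congr rfl (g := fun _ => S1 A s hs q)]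
  · rw [Finset.sum_const, Finset.card_univ, Fintype.card_fin, nsmul_eq_mul]
  intro k _
  have hk : (k:ℕ) < N + 1 := by omega
  rw [sum_insertNth k]
  simp_rw [sum_insertNth (α := Fin m) k]
  have main : ∀ (x : MD (N+1) (r-1)) (I : Fin s → MD (N+1) (r-1)) (y : Fin m) (σs : Fin s → Fin m),
      ∑ v : Fin (N+1) → Fin (N+1),
        ind r (k.insertNth (α := fun _ => MD (N+1) (r-1)) x I) * ((-1:ℝ)^(k:ℕ) *
          pdY (k.insertNth (α := fun _ => Fin m) y σs k)
              (k.insertNth (α := fun _ => MD (N+1) (r-1)) x I k).1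
            (A s (delTup k (fun l => (k.insertNth (α := fun _ => MD (N+1) (r-1)) x I l).1))
              (delTup k (k.insertNth (α := fun _ => Fin m) y σs))
              (fun j : Fin (N + 1 - s - 1) => v ⟨s + 1 + j, by omega⟩))
              (projJet (Nat.sub_le r 1) q)) *
        (epsSign v * ∏ l : Fin (s+1), yc (k.insertNth (α := fun _ => Fin m) y σs l)
          (addE (k.insertNth (α := fun _ => MD (N+1) (r-1)) x I l).1 (v ⟨l, by omega⟩)) q)
      = ∑ v : Fin (N+1) → Fin (N+1), ind r I * epsSign v *
          ((if ∑ i, x.1 i = r-1 then (1:ℝ) else 0) *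
        (yc y (addE x.1 (v 0)) q *
          pdY y x.1 (A s (fun l => (I l).1) σs (shiftT s v)) (projJet (Nat.sub_le r 1) q))) *
      ∏ l : Fin s, yc (σs l) (addE (I l).1 (v ⟨l + 1, by omega⟩)) q := by
    intro x I y σs
    rw [← sum_comp_perm (Fin.cycleRange (⟨k, hk⟩ : Fin (N+1)))]
    refine Finset.sum_congr rfl fun v _ => ?_
    rw [epsSign_comp, cyc_sign, ind_insertNth, delTup_insertNth]
    have e0 : delTup k (fun l => (k.insertNth (α := fun _ => MD (N+1) (r-1)) x I l).1)
        = fun l => (I l).1 := by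
      have := delTup_insertNth k x I
      funext l
      have h2 := congrArg Subtype.val (congrFun this l)
      rw [← h2]
      unfold delTup
      split_ifs <;> rfl
    have e1 : (fun j : Fin (N + 1 - s - 1) =>
        (v ∘ Fin.cycleRange (⟨k, hk⟩ : Fin (N+1))) ⟨s + 1 + j, by omega⟩) = shiftT s v := by
      funext t
      simp only [Function.comp, shiftT]
      rw [cyc_gt _ _ (by omega)]
      congr 1
      apply Fin.ext
      simp only
      omega
    have e2 : ∏ l : Fin (s+1), yc (k.insertNth (α := fun _ => Fin m) y σs l)
          (addE (k.insertNth (α := fun _ => MD (N+1) (r-1)) x I l).1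
            ((v ∘ Fin.cycleRange (⟨k, hk⟩ : Fin (N+1))) ⟨l, by omega⟩)) q
        = yc y (addE x.1 (v 0)) q *
          ∏ l : Fin s, yc (σs l) (addE (I l).1 (v ⟨l + 1, by omega⟩)) q := by
      rw [Fin.prod_univ_succAbove _ k]
      congr 1
      · simp only [Function.comp, Fin.insertNth_apply_same]
        rw [Fin.cycleRange_self]
      · refine Finset.prod_congr rfl fun l _ => ?_
        simp only [Function.comp, Fin.insertNth_apply_succAbove]
        congr 3
        apply Fin.ext
        by_cases h : l.castSucc < k
        · have h3 : (k.succAbove l : ℕ) = l := by rw [Fin.succAbove_of_castSucc_lt _ _ h]; rfl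
          have h4 : (l:ℕ) < k := h
          simp only [h3]
          rw [cyc_lt _ _ h4]
        · have h3 : (k.succAbove l : ℕ) = l + 1 := by
            rw [Fin.succAbove_of_le_castSucc _ _ (not_lt.mp h)]; rfl
          have h4 : (k:ℕ) ≤ l := not_lt.mp h
          simp only [h3]
          rw [cyc_gt _ _ (by omega)]
    rw [e0, e1, e2, Fin.insertNth_apply_same, Fin.insertNth_apply_same]
    have e4 : ((-1:ℝ)^((k:ℕ))) * ((-1:ℝ)^((k:ℕ))) = 1 := by
      rw [← mul_pow]; simp
    linear_combination (ind r I * epsSign v *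
          ((if ∑ i, x.1 i = r-1 then (1:ℝ) else 0) *
        (yc y (addE x.1 (v 0)) q *
          pdY y x.1 (A s (fun l => (I l).1) σs (shiftT s v)) (projJet (Nat.sub_le r 1) q))) *
      ∏ l : Fin s, yc (σs l) (addE (I l).1 (v ⟨l + 1, by omega⟩)) q) * e4
  refine (Finset.sum_congr rfl fun x _ => Finset.sum_congr rfl fun I _ =>
    Finset.sum_congr rfl fun y _ => Finset.sum_congr rfl fun σs _ => main x I y σs).trans ?_
  rw [sum_comm5]
  unfold S1
  refine Finset.sum_congr rfl fun I _ => Finset.sum_congr rfl fun σs _ =>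
    Finset.sum_congr rfl fun v _ => ?_
  rw [Fintype.sum_prod_type]
  simp only [Finset.mul_sum, Finset.sum_mul]

lemma LagA_eq_S {N m r : ℕ} (A : JetFam (N+1) m r) (q : Jet (N+1) m r) :
    LagA A q = ∑ s : Fin (N+1), (((s:ℕ).factorial * (N - (s:ℕ)).factorial : ℕ) : ℝ)⁻¹ *
      (S2 A s s.2 q + S1 A s s.2 q) := by
  rw [LagA_eq]
  have h1 : X (fun s I σs iv => L1 A s I σs iv) 0 (Nat.zero_le _) q = 0 := by
    unfold X L1
    simp
  have h2 : X (fun s I σs iv => L2 A s I σs iv) (N+1) le_rfl q = 0 := by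
    have hz : ∀ I σs iv p, L2 A (N+1) I σs iv p = 0 := by
      intro I σs iv p
      unfold L2
      exact Finset.sum_eq_zero (fun k _ => absurd k.2 (by omega))
    unfold X
    simp only [hz]
    simp
  rw [Fin.sum_univ_succ, Fin.sum_univ_castSucc (n := N+1)]
  have h1' : X (fun s I σs iv => L1 A s I σs iv) ((0 : Fin (N+1+1)) : ℕ)
      (Nat.le_of_lt_succ (0 : Fin (N+1+1)).2) q = 0 := h1
  have h2' : X (fun s I σs iv => L2 A s I σs iv) ((Fin.last (N+1)) : ℕ)
      (Nat.le_of_lt_succ (Fin.last (N+1)).2) q = 0 := h2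
  rw [h1', h2', mul_zero, mul_zero, zero_add, add_zero, ← Finset.sum_add_distrib]
  refine Finset.sum_congr rfl fun s _ => ?_
  have e1 : X (fun s I σs iv => L1 A s I σs iv) (s.succ : ℕ)
      (Nat.le_of_lt_succ s.succ.2) q = _ := X_L1 A s s.2 q
  have e2 : X (fun s I σs iv => L2 A s I σs iv) (s.castSucc : ℕ)
      (Nat.le_of_lt_succ s.castSucc.2) q = _ := X_L2 A s s.2 q
  rw [e1, e2]
  obtain ⟨d, hd⟩ : ∃ d, N = s + d := ⟨N - s, by omega⟩
  have a1 : N + 1 - (s.succ : ℕ) = d := by simp; omega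
  have a2 : N + 1 - (s.castSucc : ℕ) = d + 1 := by simp; omega
  have a3 : N - (s : ℕ) = d := by omega
  have a4 : N + 1 - (s : ℕ) = d + 1 := by omega
  rw [a1, a2, a3, a4]
  simp only [Fin.val_succ, Fin.val_castSucc, Nat.factorial_succ]
  have f1 : ((s:ℕ).factorial : ℝ) ≠ 0 := by positivity
  have f2 : (d.factorial : ℝ) ≠ 0 := by positivity
  push_cast
  have f3 : ((s:ℕ) : ℝ) + 1 ≠ 0 := by positivity
  have f4 : (d : ℝ) + 1 ≠ 0 := by positivity
  field_simp
  ring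

/-- every hyper-Jacobian Lagrangian is a total divergence. -/
theorem hyperJacobian_lagrangian_is_divergence (n m r : ℕ)
    (hn : 1 ≤ n) (hm : 1 ≤ m) (hr : 1 ≤ r)
    (A : JetFam n m r) (hA : IsAltSym A)
    (hAs : ∀ s I σs iv, ContDiff ℝ (⊤:ℕ∞) (A s I σs iv)) :
    ∀ p : Jet n m (r+1),
      LagA A (projJet (Nat.le_succ r) p) = ∑ j : Fin n, formalD j (Vfun A j) p := by
  intro p
  obtain ⟨N, rfl⟩ : ∃ N, n = N + 1 := ⟨n - 1, by omega⟩
  rw [LagA_eq_S, sum_formalD_Vfun hr A hAs]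

end JetVar
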